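/- Fix an integer r ≥ 2. Call a partition κ an r-core if its r-core equals κ itself (equivalently, all components of its r-quotient are empty). The map sending a partition λ to the pair (λ_c; (λ[0],…,λ[r−1])) consisting of its r-core and its r-quotient is a bijection from the set of all partitions onto the set of pairs of an r-core and an r-tuple of partitions; moreover, for every partition λ, |λ| = |λ_c| + r·(|λ[0]| + ⋯ + |λ[r−1]|). -/

import Mathlib

open scoped BigOperators Classical

namespace RSF

/-! ### Partitions -/

/-- A partition, encoded as its (0-indexed, weakly decreasing, eventually zero)
sequence of parts: `f (j-1) = λ_j`. -/
def IsPartition (f : ℕ → ℕ) : Prop :=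
  (∀ i j : ℕ, i ≤ j → f j ≤ f i) ∧ ∃ N : ℕ, ∀ i : ℕ, N ≤ i → f i = 0

/-- The size `|λ|` of a partition. -/
noncomputable def psize (f : ℕ → ℕ) : ℕ := ∑ᶠ i, f i

/-- The number of (nonzero) parts of a partition. -/
noncomputable def plen (f : ℕ → ℕ) : ℕ := sInf {N : ℕ | ∀ i : ℕ, N ≤ i → f i = 0}

/-- The empty partition. -/
def emptyPart : ℕ → ℕ := fun _ => 0

/-- The transpose (conjugate) partition: `λ'_i = #{j : λ_j ≥ i}` (0-indexed). -/
noncomputable def transposeP (f : ℕ → ℕ) : ℕ → ℕ := fun i => Nat.card {j : ℕ // i < f j}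

/-! ### Symmetric functions, Schur functions, Littlewood-Richardson coefficients -/

/-- The ring of symmetric functions `Λ = ℚ[p_1, p_2, …]`; the variable `m` stands for the
power sum `p_{m+1}`. -/
abbrev SymmAlg : Type := MvPolynomial ℕ ℚ

/-- The power sum `p_j ∈ Λ` (for `j ≥ 1`). -/
noncomputable def pwr (j : ℕ) : SymmAlg := MvPolynomial.X (j - 1)

/-- Evaluation `ev_n : Λ → ℚ[x_1,…,x_n]`, sending `p_j` to `x_1^j + ⋯ + x_n^j`. -/
noncomputable def ev (n : ℕ) : SymmAlg →ₐ[ℚ] MvPolynomial (Fin n) ℚ :=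
  MvPolynomial.aeval fun j => ∑ i : Fin n, MvPolynomial.X i ^ (j + 1)

/-- The matrix `(x_i^{λ_j + n - j})_{1 ≤ i,j ≤ n}` (0-indexed). -/
noncomputable def schurMat (f : ℕ → ℕ) (n : ℕ) :
    Matrix (Fin n) (Fin n) (MvPolynomial (Fin n) ℚ) :=
  Matrix.of fun i j => MvPolynomial.X i ^ (f (j : ℕ) + (n - 1 - (j : ℕ)))

/-- `S` is the family of Schur functions: for every partition `λ` and every `n` at least the
number of parts of `λ`, `ev_n (S_λ) = det(x_i^{λ_j+n-j}) / det(x_i^{n-j})`.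
(This determines `S_λ` uniquely.) -/
def IsSchurFamily (S : (ℕ → ℕ) → SymmAlg) : Prop :=
  ∀ f : ℕ → ℕ, IsPartition f → ∀ n : ℕ, plen f ≤ n →
    ev n (S f) * (schurMat emptyPart n).det = (schurMat f n).det

/-- `LR` is the family of (multi-factor) Littlewood–Richardson coefficients of the Schur
family `S`: `S_{μ_1} ⋯ S_{μ_m} = Σ_λ LR^λ_{μ_1⋯μ_m} S_λ`. -/
def IsLRFamily (S : (ℕ → ℕ) → SymmAlg) (LR : (ℕ → ℕ) → List (ℕ → ℕ) → ℚ) : Prop :=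
  (∀ lam L, ¬ IsPartition lam → LR lam L = 0) ∧
  (∀ lam L, LR lam L ≠ 0 → psize lam = (L.map psize).sum) ∧
  (∀ L : List (ℕ → ℕ), (∀ g ∈ L, IsPartition g) →
    (L.map S).prod = ∑ᶠ lam : ℕ → ℕ, LR lam L • S lam)

/-- The ring `P^(r) = ℚ[t_j : j ≥ 1, r ∤ j]`. -/
abbrev PR (r : ℕ) : Type := MvPolynomial {j : ℕ // 0 < j ∧ ¬ r ∣ j} ℚ

/-- The homomorphism `ρ^(r) : Λ → P^(r)`, `p_j ↦ j·t_j` if `r ∤ j`, `p_j ↦ 0` if `r ∣ j`. -/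
noncomputable def rho (r : ℕ) : SymmAlg →ₐ[ℚ] PR r :=
  MvPolynomial.aeval fun m =>
    if h : r ∣ (m + 1) then 0
    else ((m + 1 : ℕ) : ℚ) • MvPolynomial.X ⟨m + 1, Nat.succ_pos m, h⟩

/-! ### Beta-sets, cores, quotients, and the `r`-sign -/

/-- The beta-set `{λ_i + N - i : 1 ≤ i ≤ N}` of a partition (first-`N` beta numbers);
it is the set of nonnegative entries of the representative of the corresponding Maya
diagram whose negative entries are exactly `{-1, -2, -3, …}` and which has `N`
nonnegative entries. -/
def betaFinset (f : ℕ → ℕ) (N : ℕ) : Finset ℕ :=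
  (Finset.range N).image fun i => f i + (N - 1 - i)

/-- The elements of a finite set of naturals, listed in decreasing order. -/
def descSort (s : Finset ℕ) : List ℕ := (s.sort (· ≤ ·)).reverse

/-- The partition whose beta-set (with `s.card` beta numbers) is `s`:
`λ_j = b_j - (card - j)` where `b_1 > b_2 > ⋯` are the elements of `s`. -/
def partOfBeta (s : Finset ℕ) : ℕ → ℕ :=
  fun j => (descSort s).getD j 0 - (s.card - 1 - j)

/-- A canonical choice of `N`: a multiple of `r` which is at least the number of parts.
(The constructions below are independent of this choice.) -/
noncomputable def defaultN (r : ℕ) (f : ℕ → ℕ) : ℕ := r * (plen f + 1)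

/-- The `k`-th component `λ[k]` of the `r`-quotient of a partition. -/
noncomputable def quotP (r : ℕ) (f : ℕ → ℕ) (k : ℕ) : ℕ → ℕ :=
  partOfBeta (((betaFinset f (defaultN r f)).filter fun b => b % r = k).image
    fun b => (b - k) / r)

/-- The `r`-core `λ_c` of a partition. -/
noncomputable def coreP (r : ℕ) (f : ℕ → ℕ) : ℕ → ℕ :=
  partOfBeta ((Finset.range r).biUnion fun k =>
    (Finset.range (((betaFinset f (defaultN r f)).filter fun b => b % r = k).card)).image
      fun j => j * r + k)

/-- The interleaved reading of the nonnegative entries: for `j = 1, 2, …` and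
`k = 0, …, r-1`, the `j`-th largest beta number congruent to `k` mod `r` (if it exists). -/
def interleaveAt (r N : ℕ) (f : ℕ → ℕ) : List ℕ :=
  (List.range N).flatMap fun j =>
    (List.range r).filterMap fun k =>
      (descSort ((betaFinset f N).filter fun b => b % r = k))[j]?

/-- The number of inversions of a list of naturals with respect to decreasing order. -/
def invCount (L : List ℕ) : ℕ :=
  ((Finset.range L.length ×ˢ Finset.range L.length).filter fun pq =>
    pq.1 < pq.2 ∧ L.getD pq.1 0 < L.getD pq.2 0).card

/-- The sign of the permutation sorting the interleaved reading of the nonnegative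
entries of the chosen representative into decreasing order. -/
def deltaSignAt (r N : ℕ) (f : ℕ → ℕ) : ℤ := (-1) ^ invCount (interleaveAt r N f)

/-- The `r`-sign `δ_r(λ)`: the sign of the permutation sorting the interleaved reading of
the nonnegative entries into decreasing order.  (It is normalized relative to the `r`-core,
so as to be independent of the choice of representative; on `r`-cores it is `+1`.) -/
noncomputable def deltaSign (r : ℕ) (f : ℕ → ℕ) : ℤ :=
  deltaSignAt r (defaultN r f) f * deltaSignAt r (defaultN r f) (coreP r f)

/-! ### Generalized Maya diagrams -/

/-- A generalized Maya diagram (as a sequence): `α_{i+1} = α_i - 1` for all large `i`. -/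
def IsMaya (a : ℕ → ℤ) : Prop := ∃ N : ℕ, ∀ i : ℕ, N ≤ i → a (i + 1) = a i - 1

/-- A strictly decreasing sequence (member of `M_d`). -/
def StrictDec (a : ℕ → ℤ) : Prop := ∀ i j : ℕ, i < j → a j < a i

/-- The action of `S_n ⊆ S_∞` on sequences, permuting the first `n` entries. -/
def permAct {n : ℕ} (σ : Equiv.Perm (Fin n)) (a : ℕ → ℤ) : ℕ → ℤ :=
  fun i => if h : i < n then a ((σ⁻¹ ⟨i, h⟩ : Fin n) : ℕ) else a i

/-- `f = λ(a)` : the partition associated with a strictly decreasing Maya sequence,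
`λ_j = a_j - a_n + (j - n)` for all sufficiently large `n`. -/
def MayaCorresponds (a : ℕ → ℤ) (f : ℕ → ℕ) : Prop :=
  ∃ N : ℕ, ∀ n : ℕ, N ≤ n → ∀ j : ℕ, j ≤ n →
    (f j : ℤ) = a j - a n + (j : ℤ) - (n : ℤ)

/-- `α + c·ε_i` : increase the `i`-th entry by `c`. -/
def addAt (a : ℕ → ℤ) (i : ℕ) (c : ℤ) : ℕ → ℤ := Function.update a i (a i + c)

/-- `SM` extends the Schur family `S` to generalized Maya diagrams:
`S_α = sgn(σ)·S_{λ(σα)}` when `σα` is strictly decreasing, and `S_α = 0` when `α` has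
two equal entries. -/
def IsMayaSchur (S : (ℕ → ℕ) → SymmAlg) (SM : (ℕ → ℤ) → SymmAlg) : Prop :=
  (∀ a : ℕ → ℤ, IsMaya a → (∃ i j : ℕ, i ≠ j ∧ a i = a j) → SM a = 0) ∧
  (∀ a : ℕ → ℤ, IsMaya a → ∀ (n : ℕ) (σ : Equiv.Perm (Fin n)) (f : ℕ → ℕ),
    StrictDec (permAct σ a) → MayaCorresponds (permAct σ a) f →
    SM a = ((Equiv.Perm.sign σ : ℤ) : ℚ) • S f)

/-- The `k`-th piece `α[k]` of the `r`-quotient of a Maya sequence (in its canonical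
representative): the subsequence of entries congruent to `k` mod `r`, with
`α^{(k)}_i ↦ (α^{(k)}_i - k)/r`. -/
noncomputable def mayaQuot (r : ℕ) (b : ℕ → ℤ) (k : ℕ) : ℕ → ℤ :=
  fun i => (b (Nat.nth (fun m => b m % (r : ℤ) = (k : ℤ)) i) - (k : ℤ)) / (r : ℤ)

/-! ### The space `U` -/

/-- Maya sequences. -/
def MSeq : Type := {a : ℕ → ℤ // IsMaya a}

/-- Two Maya sequences are equivalent iff they differ by a constant. -/
def mayaSetoid : Setoid MSeq where
  r a b := ∃ c : ℤ, ∀ i : ℕ, a.1 i = b.1 i + c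
  iseqv := by
    refine ⟨fun a => ⟨0, fun i => by ring⟩, ?_, ?_⟩
    · rintro a b ⟨c, h⟩
      exact ⟨-c, fun i => by have := h i; omega⟩
    · rintro a b c ⟨x, h⟩ ⟨y, h'⟩
      exact ⟨x + y, fun i => by have := h i; have := h' i; omega⟩

/-- The set `M` of generalized Maya diagrams. -/
def MayaCl : Type := Quotient mayaSetoid

/-- Permuting the first `n` entries preserves Maya sequences. -/
def permActM {n : ℕ} (σ : Equiv.Perm (Fin n)) (a : MSeq) : MSeq :=
  ⟨permAct σ a.1, by
    obtain ⟨N, hN⟩ := a.2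
    refine ⟨max N n, fun i hi => ?_⟩
    have h1 : ¬ i < n := by omega
    have h2 : ¬ i + 1 < n := by omega
    simp only [permAct, dif_neg h1, dif_neg h2]
    exact hN i (le_trans (le_max_left _ _) hi)⟩

/-- `α + c·ε_i` as a Maya sequence. -/
def addAtM (a : MSeq) (i : ℕ) (c : ℤ) : MSeq :=
  ⟨addAt a.1 i c, by
    obtain ⟨N, hN⟩ := a.2
    refine ⟨max N (i + 1), fun m hm => ?_⟩
    have h1 : m ≠ i := by omega
    have h2 : m + 1 ≠ i := by omega
    simp only [addAt, Function.update_apply, if_neg h1, if_neg h2]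
    exact hN m (le_trans (le_max_left _ _) hm)⟩

/-- The ℚ-vector space with basis `{u_α : α ∈ M}`. -/
abbrev FreeM : Type := MayaCl →₀ ℚ

/-- The vectors `u_{σα} - sgn(σ)·u_α`. -/
def relSet : Set FreeM :=
  {v | ∃ (a : MSeq) (n : ℕ) (σ : Equiv.Perm (Fin n)),
    v = Finsupp.single (Quotient.mk mayaSetoid (permActM σ a)) 1
      - ((Equiv.Perm.sign σ : ℤ) : ℚ) • Finsupp.single (Quotient.mk mayaSetoid a) 1}

/-- The space `U`. -/
abbrev Usp : Type := FreeM ⧸ Submodule.span ℚ relSet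

/-- The image of `u_α` in `U`. -/
noncomputable def uCl (α : MayaCl) : Usp :=
  Submodule.Quotient.mk (Finsupp.single α 1)

/-! ### Skew diagrams and rim hooks -/

/-- The cells of the skew diagram `μ/λ` (0-indexed rows and columns). -/
def cells (f g : ℕ → ℕ) : Set (ℕ × ℕ) := {c | f c.1 ≤ c.2 ∧ c.2 < g c.1}

/-- Two cells are adjacent iff they share an edge. -/
def adjCell (c d : ℕ × ℕ) : Prop :=
  (c.1 = d.1 ∧ (c.2 = d.2 + 1 ∨ d.2 = c.2 + 1)) ∨
  (c.2 = d.2 ∧ (c.1 = d.1 + 1 ∨ d.1 = c.1 + 1))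

/-- A set of cells is edgewise connected. -/
def ConnectedCells (s : Set (ℕ × ℕ)) : Prop :=
  ∀ c ∈ s, ∀ d ∈ s, Relation.ReflTransGen (fun x y => x ∈ s ∧ y ∈ s ∧ adjCell x y) c d

/-- No 2×2 block of cells. -/
def No2x2 (s : Set (ℕ × ℕ)) : Prop :=
  ¬ ∃ i j : ℕ, (i, j) ∈ s ∧ (i + 1, j) ∈ s ∧ (i, j + 1) ∈ s ∧ (i + 1, j + 1) ∈ s

/-- `μ/λ` is an `r`-hook (rim hook of length `r`). -/
def IsRHook (r : ℕ) (f g : ℕ → ℕ) : Prop :=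
  psize g = psize f + r ∧ ConnectedCells (cells f g) ∧ No2x2 (cells f g)

/-! ### Beta-sets and partitions -/

lemma plen_spec {f : ℕ → ℕ} (hf : IsPartition f) {i : ℕ} (hi : plen f ≤ i) : f i = 0 :=
  Nat.sInf_mem (s := {N : ℕ | ∀ i : ℕ, N ≤ i → f i = 0}) hf.2 i hi

lemma beta_lt {f : ℕ → ℕ} (hf : IsPartition f) {N i j : ℕ} (hij : i < j) (hj : j < N) :
    f j + (N - 1 - j) < f i + (N - 1 - i) := by
  have := hf.1 i j hij.le
  omega

lemma beta_injOn {f : ℕ → ℕ} (hf : IsPartition f) (N : ℕ) :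
    Set.InjOn (fun i => f i + (N - 1 - i)) (Finset.range N : Set ℕ) := by
  intro i hi j hj h
  simp only [Finset.coe_range, Set.mem_Iio] at hi hj h
  rcases lt_trichotomy i j with hlt | heq | hlt
  · have := beta_lt hf hlt hj
    omega
  · exact heq
  · have := beta_lt hf hlt hi
    omega

lemma card_betaFinset {f : ℕ → ℕ} (hf : IsPartition f) (N : ℕ) :
    (betaFinset f N).card = N := by
  rw [betaFinset, Finset.card_image_of_injOn (beta_injOn hf N), Finset.card_range]

lemma mem_descSort {s : Finset ℕ} {b : ℕ} : b ∈ descSort s ↔ b ∈ s := by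
  simp [descSort]

lemma length_descSort (s : Finset ℕ) : (descSort s).length = s.card := by
  simp [descSort]

lemma pairwise_descSort (s : Finset ℕ) : (descSort s).Pairwise (· > ·) := by
  rw [descSort, List.pairwise_reverse]
  exact (Finset.sortedLT_sort s).pairwise

lemma descSort_betaFinset {f : ℕ → ℕ} (hf : IsPartition f) (N : ℕ) :
    descSort (betaFinset f N) = (List.range N).map fun i => f i + (N - 1 - i) := by
  refine List.Pairwise.eq_of_mem_iff (r := (· > ·)) (pairwise_descSort _) ?_ ?_
  · rw [List.pairwise_map]
    refine List.Pairwise.imp_of_mem ?_ List.pairwise_lt_range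
    intro i j _ hj hij
    exact beta_lt hf hij (List.mem_range.1 hj)
  · intro b
    simp [mem_descSort, betaFinset]

lemma partOfBeta_betaFinset {f : ℕ → ℕ} (hf : IsPartition f) {N : ℕ}
    (hN : ∀ i, N ≤ i → f i = 0) : partOfBeta (betaFinset f N) = f := by
  funext j
  rw [partOfBeta, card_betaFinset hf, descSort_betaFinset hf]
  rcases lt_or_ge j N with hj | hj
  · simp [hj]
  · simp [hj, hN j hj]

lemma descSort_gap (s : Finset ℕ) {i j : ℕ} (hij : i ≤ j) (hj : j < s.card) :
    (descSort s).getD j 0 + (j - i) ≤ (descSort s).getD i 0 := by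
  induction j, hij using Nat.le_induction with
  | base => simp
  | succ j hij ih =>
    have h := List.pairwise_iff_getElem.1 (pairwise_descSort s) j (j + 1)
      (by rw [length_descSort]; omega) (by rw [length_descSort]; omega) (by omega)
    have ih := ih (by omega)
    rw [List.getD_eq_getElem _ _ (by rw [length_descSort]; omega)] at ih ⊢
    omega

lemma le_descSort_getD (s : Finset ℕ) {i : ℕ} (hi : i < s.card) :
    s.card - 1 - i ≤ (descSort s).getD i 0 := by
  have := descSort_gap s (i := i) (j := s.card - 1) (by omega) (by omega)
  omega

lemma partOfBeta_eq_zero (s : Finset ℕ) {i : ℕ} (hi : s.card ≤ i) : partOfBeta s i = 0 := by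
  simp [partOfBeta, length_descSort, hi]

lemma isPartition_partOfBeta (s : Finset ℕ) : IsPartition (partOfBeta s) := by
  refine ⟨fun i j hij => ?_, s.card, fun i => partOfBeta_eq_zero s⟩
  rcases lt_or_ge j s.card with hj | hj
  · have := descSort_gap s hij hj
    simp only [partOfBeta]
    omega
  · simp [partOfBeta_eq_zero s hj]

lemma betaFinset_partOfBeta (s : Finset ℕ) : betaFinset (partOfBeta s) s.card = s := by
  refine Finset.eq_of_subset_of_card_le (fun b hb => ?_)
    (card_betaFinset (isPartition_partOfBeta s) _).ge
  obtain ⟨i, hi, rfl⟩ := Finset.mem_image.1 hb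
  rw [Finset.mem_range] at hi
  have h := le_descSort_getD s hi
  simp only [partOfBeta]
  rw [Nat.sub_add_cancel h, List.getD_eq_getElem _ _ (by rwa [length_descSort]), ← mem_descSort]
  exact List.getElem_mem _

lemma psize_eq_sum_range {f : ℕ → ℕ} {N : ℕ} (hN : ∀ i, N ≤ i → f i = 0) :
    psize f = ∑ i ∈ Finset.range N, f i := by
  refine finsum_eq_sum_of_support_subset _ fun i hi => ?_
  by_contra h
  exact hi (hN i (by simpa using h))

lemma psize_partOfBeta (s : Finset ℕ) :
    psize (partOfBeta s) + ∑ i ∈ Finset.range s.card, i = ∑ b ∈ s, b := by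
  conv_rhs => rw [← betaFinset_partOfBeta s, betaFinset,
    Finset.sum_image (beta_injOn (isPartition_partOfBeta s) _), Finset.sum_add_distrib]
  rw [psize_eq_sum_range fun i => partOfBeta_eq_zero s, Finset.sum_range_reflect (fun i => i)]

/-! ### Shifting beta-sets -/

/-- The beta-set obtained from `s` by adjoining `m` further beta numbers. -/
def shiftBeta (m : ℕ) (s : Finset ℕ) : Finset ℕ := Finset.range m ∪ s.image (· + m)

lemma mem_shiftBeta {m b : ℕ} {s : Finset ℕ} :
    b ∈ shiftBeta m s ↔ b < m ∨ m ≤ b ∧ b - m ∈ s := by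
  simp only [shiftBeta, Finset.mem_union, Finset.mem_range, Finset.mem_image]
  refine or_congr_right ⟨?_, fun h => ⟨b - m, h.2, by omega⟩⟩
  rintro ⟨a, ha, rfl⟩
  simpa using ha

lemma betaFinset_add {f : ℕ → ℕ} {N : ℕ} (hN : ∀ i, N ≤ i → f i = 0) (m : ℕ) :
    betaFinset f (N + m) = shiftBeta m (betaFinset f N) := by
  ext b
  simp only [mem_shiftBeta, betaFinset, Finset.mem_image, Finset.mem_range]
  constructor
  · rintro ⟨i, hi, rfl⟩
    rcases lt_or_ge i N with h | h
    · exact Or.inr ⟨by omega, i, h, by omega⟩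
    · have := hN i h
      omega
  · rintro (h | ⟨h, i, hi, hb⟩)
    · refine ⟨N + m - 1 - b, by omega, ?_⟩
      rw [hN _ (by omega)]
      omega
    · exact ⟨i, by omega, by omega⟩

lemma partOfBeta_shiftBeta (m : ℕ) (s : Finset ℕ) :
    partOfBeta (shiftBeta m s) = partOfBeta s := by
  have h : ∀ i, s.card ≤ i → partOfBeta s i = 0 := fun i => partOfBeta_eq_zero s
  conv_lhs => rw [← betaFinset_partOfBeta s, ← betaFinset_add h]
  exact partOfBeta_betaFinset (isPartition_partOfBeta s) fun i hi => h i (by omega)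

/-! ### Runners of the abacus -/

/-- The positions of the beads of `s` on the `k`-th runner of the `r`-abacus. -/
def runner (r : ℕ) (s : Finset ℕ) (k : ℕ) : Finset ℕ :=
  (s.filter fun b => b % r = k).image fun b => (b - k) / r

/-- The beta-set whose beads on the `k`-th runner have positions `t k`. -/
def ofRunners (r : ℕ) (t : ℕ → Finset ℕ) : Finset ℕ :=
  (Finset.range r).biUnion fun k => (t k).image fun j => j * r + k

lemma mem_runner {r k j : ℕ} (hk : k < r) {s : Finset ℕ} :
    j ∈ runner r s k ↔ j * r + k ∈ s := by
  simp only [runner, Finset.mem_image, Finset.mem_filter]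
  constructor
  · rintro ⟨b, ⟨hb, rfl⟩, rfl⟩
    rwa [Nat.div_mul_cancel (Nat.dvd_sub_mod b), Nat.sub_add_cancel (Nat.mod_le b r)]
  · intro h
    refine ⟨_, ⟨h, by rw [Nat.mul_add_mod_self_right, Nat.mod_eq_of_lt hk]⟩, ?_⟩
    rw [Nat.add_sub_cancel, Nat.mul_div_cancel _ (by omega)]

lemma mem_ofRunners {r k j : ℕ} (hk : k < r) {t : ℕ → Finset ℕ} :
    j * r + k ∈ ofRunners r t ↔ j ∈ t k := by
  simp only [ofRunners, Finset.mem_biUnion, Finset.mem_range, Finset.mem_image]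
  constructor
  · rintro ⟨k', hk', j', hj', h⟩
    have hkk : k' = k := by
      simpa [Nat.mul_add_mod_self_right, Nat.mod_eq_of_lt, hk, hk'] using congrArg (· % r) h
    subst hkk
    have : j' = j := Nat.eq_of_mul_eq_mul_right (by omega : 0 < r) (by omega)
    rwa [← this]
  · exact fun h => ⟨k, hk, j, h, rfl⟩

lemma runner_ofRunners {r k : ℕ} (hk : k < r) (t : ℕ → Finset ℕ) :
    runner r (ofRunners r t) k = t k := by
  ext j
  rw [mem_runner hk, mem_ofRunners hk]

lemma eq_of_runner_eq {r : ℕ} (hr : 0 < r) {s t : Finset ℕ}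
    (h : ∀ k < r, runner r s k = runner r t k) : s = t := by
  ext b
  have hb := Nat.mod_lt b hr
  have := Finset.ext_iff.1 (h _ hb) (b / r)
  rwa [mem_runner hb, mem_runner hb, Nat.div_add_mod'] at this

lemma ofRunners_runner {r : ℕ} (hr : 0 < r) (s : Finset ℕ) : ofRunners r (runner r s) = s :=
  eq_of_runner_eq hr fun _ hk => runner_ofRunners hk _

lemma sum_ofRunners {r : ℕ} (t : ℕ → Finset ℕ) (g : ℕ → ℕ) :
    ∑ b ∈ ofRunners r t, g b = ∑ k ∈ Finset.range r, ∑ j ∈ t k, g (j * r + k) := by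
  rw [ofRunners, Finset.sum_biUnion]
  · refine Finset.sum_congr rfl fun k hk => Finset.sum_image fun i _ j _ h => ?_
    have hk := Finset.mem_range.1 hk
    exact Nat.eq_of_mul_eq_mul_right (by omega : 0 < r) (Nat.add_right_cancel h)
  · intro k hk k' hk' hne
    simp only [Finset.coe_range, Set.mem_Iio] at hk hk'
    refine Finset.disjoint_left.2 fun b hb hb' => hne ?_
    obtain ⟨j, -, rfl⟩ := Finset.mem_image.1 hb
    obtain ⟨j', -, h⟩ := Finset.mem_image.1 hb'
    simpa [Nat.mul_add_mod_self_right, Nat.mod_eq_of_lt, hk, hk'] using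
      (congrArg (· % r) h).symm

lemma card_ofRunners {r : ℕ} (t : ℕ → Finset ℕ) :
    (ofRunners r t).card = ∑ k ∈ Finset.range r, (t k).card := by
  simp only [Finset.card_eq_sum_ones, sum_ofRunners]

lemma card_filter_mod {r k : ℕ} (hk : k < r) (s : Finset ℕ) :
    (s.filter fun b => b % r = k).card = (runner r s k).card := by
  rw [runner, Finset.card_image_of_injOn]
  intro a ha b hb h
  obtain ⟨-, rfl⟩ := Finset.mem_filter.1 ha
  obtain ⟨-, hb⟩ := Finset.mem_filter.1 hb
  have h' := congrArg (· * r) h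
  simp only at h'
  rw [Nat.div_mul_cancel (Nat.dvd_sub_mod a), ← hb, Nat.div_mul_cancel (Nat.dvd_sub_mod b)] at h'
  have := Nat.mod_le a r
  have := Nat.mod_le b r
  omega

lemma runner_shiftBeta {r k : ℕ} (hk : k < r) (m : ℕ) (s : Finset ℕ) :
    runner r (shiftBeta (r * m) s) k = shiftBeta m (runner r s k) := by
  ext j
  rw [mem_runner hk, mem_shiftBeta, mem_shiftBeta, mem_runner hk]
  rcases lt_or_ge j m with h | h
  · have : j * r + k < r * m := by nlinarith
    simp [h, this]
  · obtain ⟨d, rfl⟩ := Nat.exists_eq_add_of_le h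
    have h1 : (m + d) * r + k = r * m + (d * r + k) := by ring
    simp [h1]

lemma shiftBeta_range (m n : ℕ) : shiftBeta m (Finset.range n) = Finset.range (n + m) := by
  ext b
  simp only [mem_shiftBeta, Finset.mem_range]
  omega

lemma card_shiftBeta (m : ℕ) (s : Finset ℕ) : (shiftBeta m s).card = s.card + m := by
  have h : ∀ i, s.card ≤ i → partOfBeta s i = 0 := fun i => partOfBeta_eq_zero s
  conv_lhs => rw [← betaFinset_partOfBeta s, ← betaFinset_add h]
  exact card_betaFinset (isPartition_partOfBeta s) _

/-- Push all beads of `s` down on the runners of the `r`-abacus. -/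
def coreSet (r : ℕ) (s : Finset ℕ) : Finset ℕ :=
  ofRunners r fun k => Finset.range (runner r s k).card

lemma runner_coreSet {r k : ℕ} (hk : k < r) (s : Finset ℕ) :
    runner r (coreSet r s) k = Finset.range (runner r s k).card :=
  runner_ofRunners hk _

lemma coreSet_congr {r : ℕ} (hr : 0 < r) {s t : Finset ℕ}
    (h : ∀ k < r, (runner r s k).card = (runner r t k).card) : coreSet r s = coreSet r t :=
  eq_of_runner_eq hr fun k hk => by rw [runner_coreSet hk, runner_coreSet hk, h k hk]

lemma coreSet_coreSet {r : ℕ} (hr : 0 < r) (s : Finset ℕ) :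
    coreSet r (coreSet r s) = coreSet r s :=
  coreSet_congr hr fun k hk => by rw [runner_coreSet hk, Finset.card_range]

lemma card_coreSet {r : ℕ} (hr : 0 < r) (s : Finset ℕ) : (coreSet r s).card = s.card := by
  conv_rhs => rw [← ofRunners_runner hr s]
  simp [coreSet, card_ofRunners]

lemma coreSet_shiftBeta {r : ℕ} (hr : 0 < r) (m : ℕ) (s : Finset ℕ) :
    coreSet r (shiftBeta (r * m) s) = shiftBeta (r * m) (coreSet r s) :=
  eq_of_runner_eq hr fun k hk => by
    rw [runner_coreSet hk, runner_shiftBeta hk, runner_shiftBeta hk, runner_coreSet hk,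
      shiftBeta_range, card_shiftBeta]

/-! ### Cores and quotients -/

lemma defaultN_spec {r : ℕ} (hr : 0 < r) {f : ℕ → ℕ} (hf : IsPartition f) {i : ℕ}
    (hi : r * (plen f + 1) ≤ i) : f i = 0 :=
  plen_spec hf (by nlinarith)

lemma quotP_eq {r k : ℕ} (hk : k < r) {f : ℕ → ℕ} (hf : IsPartition f) {M : ℕ}
    (hM : ∀ i, r * M ≤ i → f i = 0) :
    quotP r f k = partOfBeta (runner r (betaFinset f (r * M)) k) := by
  have hD := fun i => defaultN_spec (by omega : 0 < r) hf (i := i)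
  change partOfBeta (runner r (betaFinset f (r * (plen f + 1))) k) = _
  rw [← partOfBeta_shiftBeta M, ← runner_shiftBeta hk, ← betaFinset_add hD,
    ← partOfBeta_shiftBeta (plen f + 1) (runner r (betaFinset f (r * M)) k),
    ← runner_shiftBeta hk, ← betaFinset_add hM, add_comm]

lemma coreP_eq {r : ℕ} (hr : 0 < r) {f : ℕ → ℕ} (hf : IsPartition f) {M : ℕ}
    (hM : ∀ i, r * M ≤ i → f i = 0) :
    coreP r f = partOfBeta (coreSet r (betaFinset f (r * M))) := by
  have hD := fun i => defaultN_spec hr hf (i := i)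
  have h : coreP r f = partOfBeta (coreSet r (betaFinset f (r * (plen f + 1)))) := by
    refine congrArg partOfBeta (Finset.biUnion_congr rfl fun k hk => ?_)
    rw [card_filter_mod (Finset.mem_range.1 hk), defaultN]
  rw [h, ← partOfBeta_shiftBeta (r * M), ← coreSet_shiftBeta hr, ← betaFinset_add hD,
    ← partOfBeta_shiftBeta (r * (plen f + 1)) (coreSet r (betaFinset f (r * M))),
    ← coreSet_shiftBeta hr, ← betaFinset_add hM, add_comm]

lemma eq_of_partOfBeta_eq {s t : Finset ℕ} (hc : s.card = t.card)
    (h : partOfBeta s = partOfBeta t) : s = t := by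
  rw [← betaFinset_partOfBeta s, h, hc, betaFinset_partOfBeta]

lemma coreP_coreP {r : ℕ} (hr : 0 < r) {f : ℕ → ℕ} (hf : IsPartition f) :
    coreP r (coreP r f) = coreP r f := by
  have hD := fun i => defaultN_spec hr hf (i := i)
  rw [coreP_eq hr hf hD]
  set s := betaFinset f (r * (plen f + 1)) with hs
  have hc : (coreSet r s).card = r * (plen f + 1) := by
    rw [card_coreSet hr, hs, card_betaFinset hf]
  rw [coreP_eq hr (isPartition_partOfBeta _) (M := plen f + 1)
    fun i hi => partOfBeta_eq_zero _ (hc.trans_le hi), ← hc, betaFinset_partOfBeta,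
    coreSet_coreSet hr]

lemma eq_of_coreP_eq_of_quotP_eq {r : ℕ} (hr : 0 < r) {f g : ℕ → ℕ} (hf : IsPartition f)
    (hg : IsPartition g) (hc : coreP r f = coreP r g)
    (hq : ∀ k < r, quotP r f k = quotP r g k) : f = g := by
  have hF : ∀ i, r * (plen f + plen g) ≤ i → f i = 0 := fun i hi => plen_spec hf (by nlinarith)
  have hG : ∀ i, r * (plen f + plen g) ≤ i → g i = 0 := fun i hi => plen_spec hg (by nlinarith)
  rw [coreP_eq hr hf hF, coreP_eq hr hg hG] at hc
  have hc := eq_of_partOfBeta_eq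
    (by rw [card_coreSet hr, card_coreSet hr, card_betaFinset hf, card_betaFinset hg]) hc
  refine (partOfBeta_betaFinset hf hF).symm.trans (Eq.trans (congrArg partOfBeta
    (eq_of_runner_eq hr fun k hk => eq_of_partOfBeta_eq ?_ ?_)) (partOfBeta_betaFinset hg hG))
  · have := congrArg (fun s => (runner r s k).card) hc
    simpa [runner_coreSet hk] using this
  · rw [← quotP_eq hk hf hF, ← quotP_eq hk hg hG, hq k hk]

lemma exists_coreP_eq_and_quotP_eq {r : ℕ} (hr : 0 < r) {c : ℕ → ℕ} (hc : IsPartition c)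
    (hcore : coreP r c = c) {q : ℕ → ℕ → ℕ} (hq : ∀ k < r, IsPartition (q k)) :
    ∃ f, IsPartition f ∧ coreP r f = c ∧ ∀ k < r, quotP r f k = q k := by
  set L := ∑ k ∈ Finset.range r, plen (q k) with hL
  set M := plen c + L with hM
  have hC : ∀ i, r * plen c ≤ i → c i = 0 := fun i hi => plen_spec hc (by nlinarith)
  have hC' : ∀ i, r * M ≤ i → c i = 0 := fun i hi => plen_spec hc (by nlinarith)
  set u := betaFinset c (r * M) with hu
  have hlarge : ∀ k < r, plen (q k) ≤ (runner r u k).card := by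
    intro k hk
    rw [hu, hM, mul_add, betaFinset_add hC, runner_shiftBeta hk, card_shiftBeta]
    exact (Finset.single_le_sum (f := fun k => plen (q k)) (fun _ _ => Nat.zero_le _)
      (Finset.mem_range.2 hk)).trans (Nat.le_add_left _ _)
  set s := ofRunners r fun k => betaFinset (q k) (runner r u k).card with hs
  have hrun : ∀ k < r, runner r s k = betaFinset (q k) (runner r u k).card :=
    fun k hk => runner_ofRunners hk _
  have hcs : coreSet r s = coreSet r u :=
    coreSet_congr hr fun k hk => by rw [hrun k hk, card_betaFinset (hq k hk)]
  have hcard : s.card = r * M := by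
    rw [← card_coreSet hr s, hcs, card_coreSet hr, hu, card_betaFinset hc]
  have hS : ∀ i, r * M ≤ i → partOfBeta s i = 0 :=
    fun i hi => partOfBeta_eq_zero s (hcard.trans_le hi)
  have hp := isPartition_partOfBeta s
  have hb : betaFinset (partOfBeta s) (r * M) = s := by rw [← hcard, betaFinset_partOfBeta]
  refine ⟨partOfBeta s, hp, ?_, fun k hk => ?_⟩
  · rw [coreP_eq hr hp hS, hb, hcs, ← coreP_eq hr hc hC', hcore]
  · rw [quotP_eq hk hp hS, hb, hrun k hk]
    exact partOfBeta_betaFinset (hq k hk)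
      fun i hi => plen_spec (hq k hk) ((hlarge k hk).trans hi)

lemma psize_eq_core_add_quot {r : ℕ} (hr : 0 < r) {f : ℕ → ℕ} (hf : IsPartition f) :
    psize f = psize (coreP r f) + r * ∑ k ∈ Finset.range r, psize (quotP r f k) := by
  have hD := fun i => defaultN_spec hr hf (i := i)
  set s := betaFinset f (r * (plen f + 1)) with hs
  have h1 := psize_partOfBeta s
  have h2 := psize_partOfBeta (coreSet r s)
  rw [card_coreSet hr, ← coreP_eq hr hf hD] at h2
  rw [partOfBeta_betaFinset hf hD] at h1
  have h3 : ∑ b ∈ s, b = ∑ b ∈ coreSet r s, b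
      + r * ∑ k ∈ Finset.range r, psize (quotP r f k) := by
    conv_lhs => rw [← ofRunners_runner hr s]
    rw [coreSet, sum_ofRunners, sum_ofRunners, Finset.mul_sum, ← Finset.sum_add_distrib]
    refine Finset.sum_congr rfl fun k hk => ?_
    rw [quotP_eq (Finset.mem_range.1 hk) hf hD, ← hs, Finset.sum_add_distrib,
      Finset.sum_add_distrib, ← Finset.sum_mul, ← Finset.sum_mul, ← psize_partOfBeta]
    simp only [Finset.sum_const, Finset.card_range]
    ring
  omega

/-- The map `λ ↦ (λ_c; (λ[0], …, λ[r-1]))` is a bijection from the set of partitions onto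
the set of pairs of an `r`-core and an `r`-tuple of partitions; moreover
`|λ| = |λ_c| + r·(|λ[0]| + ⋯ + |λ[r-1]|)`. -/
theorem core_quotient_bijection (r : ℕ) (hr : 2 ≤ r) :
    Set.BijOn (fun f : ℕ → ℕ => (coreP r f, fun k : Fin r => quotP r f (k : ℕ)))
      {f : ℕ → ℕ | IsPartition f}
      {p : (ℕ → ℕ) × (Fin r → ℕ → ℕ) |
        IsPartition p.1 ∧ coreP r p.1 = p.1 ∧ ∀ k : Fin r, IsPartition (p.2 k)} ∧
    ∀ f : ℕ → ℕ, IsPartition f →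
      psize f = psize (coreP r f) + r * ∑ k ∈ Finset.range r, psize (quotP r f k) := by
  have hr0 : 0 < r := by omega
  refine ⟨⟨fun f hf => ?_, fun f hf g hg h => ?_, fun p hp => ?_⟩,
    fun f hf => psize_eq_core_add_quot hr0 hf⟩
  · exact ⟨isPartition_partOfBeta _, coreP_coreP hr0 hf, fun k => isPartition_partOfBeta _⟩
  · have h := Prod.mk.inj h
    exact eq_of_coreP_eq_of_quotP_eq hr0 hf hg h.1 fun k hk => congrFun h.2 ⟨k, hk⟩
  · obtain ⟨c, q⟩ := p
    obtain ⟨hc, hcore, hq⟩ := hp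
    obtain ⟨f, hf, hfc, hfq⟩ := exists_coreP_eq_and_quotP_eq hr0 hc hcore
      (q := fun k => if h : k < r then q ⟨k, h⟩ else emptyPart)
      fun k hk => by simpa [hk] using hq ⟨k, hk⟩
    exact ⟨f, hf, Prod.ext hfc (funext fun k => by simpa using hfq k k.2)⟩
end RSF
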